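/- The operator B is LCP at a point (x,t) ∈ (0,∞)ⁿ × [0,T] if and only if for every direction v ∈ ℝⁿ \ {0} and every convex f ∈ F with ∂_v²f(x) = 0, condition (ohly) holds at (x,t): ∫₀¹ ( f_vv(x+φ) + 2 φ_v·∇f_v(x+φ) + φ_vᵀ Hf(x+φ) φ_v + φ_vv·(∇f(x+φ) − ∇f(x)) ) dz ≥ 0, where φ = φ(x,t,z), φ_v and φ_vv denote the first and second directional x-derivatives of φ in direction v, f_v = ∂_v f, f_vv = ∂_v² f, and Hf is the Hessian of f. -/

import Mathlib

open MeasureTheory Set Matrix NNReal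

noncomputable section

/-- The open positive orthant `(0,∞)ⁿ` in `ℝⁿ`. -/
def posOrth (n : ℕ) : Set (Fin n → ℝ) := {x | ∀ i, 0 < x i}

/-- First directional derivative of `f` at `x` in direction `v`. -/
def dir1 {n : ℕ} {F : Type*} [NormedAddCommGroup F] [NormedSpace ℝ F]
    (f : (Fin n → ℝ) → F) (x v : Fin n → ℝ) : F :=
  fderiv ℝ f x v

/-- Mixed second derivative: differentiate `f` in direction `v`, then in direction `w`. -/
def dmix {n : ℕ} {F : Type*} [NormedAddCommGroup F] [NormedSpace ℝ F]
    (f : (Fin n → ℝ) → F) (x v w : Fin n → ℝ) : F :=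
  fderiv ℝ (fun y => fderiv ℝ f y v) x w

/-- Second directional derivative of `f` at `x` in direction `v`. -/
def dir2 {n : ℕ} {F : Type*} [NormedAddCommGroup F] [NormedSpace ℝ F]
    (f : (Fin n → ℝ) → F) (x v : Fin n → ℝ) : F :=
  dmix f x v v

/-- The class `F` of test functions: `C⁴` on the positive orthant, with locally Hölder
continuous fourth derivatives, and with `f` together with its derivatives up to order two
of at most polynomial growth. -/
structure MemTestClass (n : ℕ) (f : (Fin n → ℝ) → ℝ) : Prop where
  smooth : ContDiffOn ℝ 4 f (posOrth n)
  holder4 : ∃ α : ℝ≥0, 0 < α ∧ (α : ℝ) ≤ 1 ∧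
    ∀ x ∈ posOrth n, ∃ s ∈ nhds x, s ⊆ posOrth n ∧
      ∃ C : ℝ≥0, HolderOnWith C α (iteratedFDeriv ℝ 4 f) s
  polyGrowth : ∃ C m : ℝ, ∀ x ∈ posOrth n, ∀ k : ℕ, k ≤ 2 →
    ‖iteratedFDeriv ℝ k f x‖ ≤ C * (1 + ‖x‖ ^ m)

/-- The jump structure `φ(x,t,z)` together with the standing assumptions (A3), (A6), (A7). -/
structure JumpKernel (n : ℕ) (T : ℝ) where
  φ : (Fin n → ℝ) → ℝ → ℝ → (Fin n → ℝ)
  meas : ∀ x ∈ posOrth n, ∀ t ∈ Icc (0:ℝ) T, Measurable (fun z => φ x t z)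
  smooth : ∀ t ∈ Icc (0:ℝ) T, ∀ z ∈ Icc (0:ℝ) 1,
    ContDiffOn ℝ 2 (fun x => φ x t z) (posOrth n)
  holder2 : ∃ α : ℝ≥0, 0 < α ∧ (α : ℝ) ≤ 1 ∧
    ∀ t ∈ Icc (0:ℝ) T, ∀ x ∈ posOrth n, ∃ s ∈ nhds x, s ⊆ posOrth n ∧
      ∃ C : ℝ≥0, ∀ z ∈ Icc (0:ℝ) 1,
        HolderOnWith C α (iteratedFDeriv ℝ 2 (fun y => φ y t z)) s
  bound : ∃ D : ℝ, 0 < D ∧ ∀ x ∈ posOrth n, ∀ t ∈ Icc (0:ℝ) T, ∀ z ∈ Icc (0:ℝ) 1,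
    ∀ i, (φ x t z i) ^ 2 ≤ D * (x i) ^ 2
  lower : ∃ γ₀ : ℝ, -1 < γ₀ ∧ ∀ x ∈ posOrth n, ∀ t ∈ Icc (0:ℝ) T, ∀ z ∈ Icc (0:ℝ) 1,
    ∀ i, γ₀ * x i < φ x t z i

/-- For each fixed `(x,t)`, `φ(x,t,z) ≠ 0` for almost every `z ∈ [0,1]`. -/
def JumpKernel.AENonzero {n : ℕ} {T : ℝ} (K : JumpKernel n T) : Prop :=
  ∀ x ∈ posOrth n, ∀ t ∈ Icc (0:ℝ) T,
    ∀ᵐ z ∂(volume.restrict (Icc (0:ℝ) 1)), K.φ x t z ≠ 0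

/-- The jump intensity `λ` : nonnegative and Hölder continuous on `[0,T]`. -/
def LamOK (T : ℝ) (lam : ℝ → ℝ) : Prop :=
  (∀ t ∈ Icc (0:ℝ) T, 0 ≤ lam t) ∧
  ∃ α C : ℝ≥0, 0 < α ∧ (α : ℝ) ≤ 1 ∧ HolderOnWith C α lam (Icc (0:ℝ) T)

/-- The integro-differential jump operator `B`. -/
def Bop {n : ℕ} {T : ℝ} (lam : ℝ → ℝ) (K : JumpKernel n T)
    (f : (Fin n → ℝ) → ℝ) (x : Fin n → ℝ) (t : ℝ) : ℝ :=
  lam t * ∫ z in Icc (0:ℝ) 1,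
    (f (x + K.φ x t z) - f x - fderiv ℝ f x (K.φ x t z))

/-- The diffusion matrix `β(x,t)` together with the standing assumptions (A1), (A3), (A5). -/
structure DiffKernel (n : ℕ) (T : ℝ) where
  β : (Fin n → ℝ) → ℝ → Matrix (Fin n) (Fin n) ℝ
  smooth : ∀ t ∈ Icc (0:ℝ) T, ∀ i j, ContDiffOn ℝ 2 (fun x => β x t i j) (posOrth n)
  holder2 : ∃ α : ℝ≥0, 0 < α ∧ (α : ℝ) ≤ 1 ∧
    ∀ t ∈ Icc (0:ℝ) T, ∀ i j, ∀ x ∈ posOrth n, ∃ s ∈ nhds x, s ⊆ posOrth n ∧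
      ∃ C : ℝ≥0, HolderOnWith C α (iteratedFDeriv ℝ 2 (fun y => β y t i j)) s
  nonsing : ∀ x ∈ posOrth n, ∀ t ∈ Icc (0:ℝ) T, (β x t).det ≠ 0
  bound : ∃ D : ℝ, 0 < D ∧ ∀ x ∈ posOrth n, ∀ t ∈ Icc (0:ℝ) T,
    ∀ i, ∑ j, (β x t i j) ^ 2 ≤ D * (x i) ^ 2

/-- The second order differential operator `A` with coefficient matrix `a = ββ*/2`. -/
def Aop {n : ℕ} {T : ℝ} (Dk : DiffKernel n T)
    (f : (Fin n → ℝ) → ℝ) (x : Fin n → ℝ) (t : ℝ) : ℝ :=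
  ∑ i, ∑ j, ((Dk.β x t * (Dk.β x t)ᵀ) i j / 2) *
    dmix f x (Pi.single i 1) (Pi.single j 1)

/-- An operator `D` (mapping a test function `f` to a function of `(x,t)`) is locally
convexity preserving (LCP) at `(x,t)` if `∂_v²(Df)(x,t) ≥ 0` for every direction `v ≠ 0`
and every convex `f ∈ F` with `∂_v²f(x) = 0`. -/
def IsLCPAt {n : ℕ} (D : ((Fin n → ℝ) → ℝ) → (Fin n → ℝ) → ℝ → ℝ)
    (x : Fin n → ℝ) (t : ℝ) : Prop :=
  ∀ v : Fin n → ℝ, v ≠ 0 → ∀ f : (Fin n → ℝ) → ℝ,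
    MemTestClass n f → ConvexOn ℝ (posOrth n) f → dir2 f x v = 0 →
    0 ≤ dir2 (fun y => D f y t) x v

/-- The integrand in condition (ohly) of Theorem 5.1. -/
def ohlyIntegrand {n : ℕ} {T : ℝ} (K : JumpKernel n T)
    (f : (Fin n → ℝ) → ℝ) (x v : Fin n → ℝ) (t z : ℝ) : ℝ :=
  dmix f (x + K.φ x t z) v v
    + 2 * dmix f (x + K.φ x t z) v (dir1 (fun y => K.φ y t z) x v)
    + dmix f (x + K.φ x t z) (dir1 (fun y => K.φ y t z) x v)
        (dir1 (fun y => K.φ y t z) x v)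
    + (fderiv ℝ f (x + K.φ x t z) (dir2 (fun y => K.φ y t z) x v)
        - fderiv ℝ f x (dir2 (fun y => K.φ y t z) x v))


section Interpolation

variable {E F : Type*} [NormedAddCommGroup E] [NormedSpace ℝ E]
  [NormedAddCommGroup F] [NormedSpace ℝ F]

theorem opNorm_le_of_norm_apply_le_on_ball {A : E →L[ℝ] F} {r C : ℝ} (hr : 0 < r) (hC : 0 ≤ C)
    (h : ∀ w, ‖w‖ < r → ‖A w‖ ≤ C) : ‖A‖ ≤ 2 * C / r := by
  refine ContinuousLinearMap.opNorm_le_of_shell (𝕜 := ℝ) (c := 2) hr (by positivity)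
    (by norm_num) fun w hw1 hw2 => (h w hw2).trans ?_
  have hw : r / 2 ≤ ‖w‖ := by simpa using hw1
  calc C = 2 * C / r * (r / 2) := by field_simp
    _ ≤ 2 * C / r * ‖w‖ := by gcongr

theorem norm_fderiv_le_of_norm_sub_snd_le {f : E → F} {c : E} {r M K : ℝ}
    {A : E →L[ℝ] E →L[ℝ] F} (hr : 0 < r) (hf : ∀ y ∈ Metric.ball c r, DifferentiableAt ℝ f y)
    (hf' : ∀ y ∈ Metric.ball c r, DifferentiableAt ℝ (fderiv ℝ f) y)
    (hM : ∀ y ∈ Metric.ball c r, ‖f y‖ ≤ M)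
    (hK : ∀ y ∈ Metric.ball c r, ‖fderiv ℝ (fderiv ℝ f) y - A‖ ≤ K) :
    ‖fderiv ℝ f c‖ ≤ 2 * (M + K * r ^ 2) / r := by
  have hc : c ∈ Metric.ball c r := Metric.mem_ball_self hr
  have hM0 : 0 ≤ M := (norm_nonneg _).trans (hM c hc)
  have hK0 : 0 ≤ K := (norm_nonneg (fderiv ℝ (fderiv ℝ f) c - A)).trans (hK c hc)
  have key : ∀ y ∈ Metric.ball c r, ‖fderiv ℝ f y - fderiv ℝ f c - A (y - c)‖ ≤ K * r := by
    intro y hy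
    refine ((convex_ball c r).norm_image_sub_le_of_norm_fderiv_le' hf' hK hc hy).trans ?_
    have : ‖y - c‖ < r := by rwa [← mem_ball_iff_norm]
    gcongr
  refine opNorm_le_of_norm_apply_le_on_ball hr (by positivity) fun w hw => ?_
  have hp : ∀ u ∈ Metric.ball (0 : E) r, c + u ∈ Metric.ball c r := by
    intro u hu; simpa using hu
  have hm : ∀ u ∈ Metric.ball (0 : E) r, c - u ∈ Metric.ball c r := by
    intro u hu; simpa using hu
  have hd : ∀ u ∈ Metric.ball (0 : E) r,
      HasFDerivWithinAt (fun u => f (c + u) - f (c - u))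
        (fderiv ℝ f (c + u) + fderiv ℝ f (c - u)) (Metric.ball (0 : E) r) u := by
    intro u hu
    have h1 := (hf _ (hp u hu)).hasFDerivAt.comp u ((hasFDerivAt_id u).const_add c)
    have h2 := (hf _ (hm u hu)).hasFDerivAt.comp u ((hasFDerivAt_id u).const_sub c)
    refine (h1.sub h2).hasFDerivWithinAt.congr_fderiv ?_
    ext z; simp
  have hb : ∀ u ∈ Metric.ball (0 : E) r,
      ‖fderiv ℝ f (c + u) + fderiv ℝ f (c - u) - (2 : ℝ) • fderiv ℝ f c‖ ≤ 2 * (K * r) := by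
    intro u hu
    have e : fderiv ℝ f (c + u) + fderiv ℝ f (c - u) - (2 : ℝ) • fderiv ℝ f c
        = (fderiv ℝ f (c + u) - fderiv ℝ f c - A (c + u - c))
          + (fderiv ℝ f (c - u) - fderiv ℝ f c - A (c - u - c)) := by
      have e1 : A (c + u - c) = A u := by congr 1; abel
      have e2 : A (c - u - c) = - A u := by rw [← map_neg]; congr 1; abel
      rw [e1, e2, two_smul]; abel
    rw [e]
    linarith [norm_add_le (fderiv ℝ f (c + u) - fderiv ℝ f c - A (c + u - c))
      (fderiv ℝ f (c - u) - fderiv ℝ f c - A (c - u - c)), key _ (hp u hu), key _ (hm u hu)]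
  have hw' : w ∈ Metric.ball (0 : E) r := by simpa using hw
  have hmv := (convex_ball (0 : E) r).norm_image_sub_le_of_norm_hasFDerivWithin_le' hd hb
    (Metric.mem_ball_self hr) hw'
  simp only [add_zero, sub_zero, sub_self, FunLike.coe_smul, Pi.smul_apply] at hmv
  have h3 : ‖(2 : ℝ) • fderiv ℝ f c w‖ ≤ 2 * (K * r) * ‖w‖ + (M + M) := by
    calc ‖(2 : ℝ) • fderiv ℝ f c w‖
        = ‖(f (c + w) - f (c - w)) - (f (c + w) - f (c - w) - (2 : ℝ) • fderiv ℝ f c w)‖ := by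
          congr 1; abel
      _ ≤ ‖f (c + w) - f (c - w)‖ + ‖f (c + w) - f (c - w) - (2 : ℝ) • fderiv ℝ f c w‖ :=
          norm_sub_le _ _
      _ ≤ _ := by
          linarith [norm_sub_le (f (c + w)) (f (c - w)), hM _ (hp w hw'), hM _ (hm w hw')]
  rw [norm_smul, Real.norm_ofNat] at h3
  have h4 : 2 * (K * r) * ‖w‖ ≤ 2 * (K * r) * r := by gcongr
  nlinarith

theorem exists_norm_fderiv_le_of_norm_sub_snd_le (c : E) {r M K : ℝ} (hr : 0 < r) :
    ∃ L : ℝ, ∀ f : E → F, (∀ y ∈ Metric.ball c r, DifferentiableAt ℝ f y) →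
      (∀ y ∈ Metric.ball c r, DifferentiableAt ℝ (fderiv ℝ f) y) →
      (∀ y ∈ Metric.ball c r, ‖f y‖ ≤ M) →
      (∀ y ∈ Metric.ball c r, ‖fderiv ℝ (fderiv ℝ f) y - fderiv ℝ (fderiv ℝ f) c‖ ≤ K) →
      ∀ y ∈ Metric.ball c (r / 2), ‖fderiv ℝ f y‖ ≤ L ∧ ‖fderiv ℝ (fderiv ℝ f) y‖ ≤ L := by
  set L₁ := 2 * (M + K * (r / 2) ^ 2) / (r / 2) with hL₁
  set L₂ := K + 2 * (2 * L₁ + K * r) / (r / 2) with hL₂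
  refine ⟨max L₁ L₂, fun f hf hf' hM hK => ?_⟩
  have hc : c ∈ Metric.ball c r := Metric.mem_ball_self hr
  have hK0 : 0 ≤ K :=
    (norm_nonneg (fderiv ℝ (fderiv ℝ f) c - fderiv ℝ (fderiv ℝ f) c)).trans (hK c hc)
  have hsub : Metric.ball c (r / 2) ⊆ Metric.ball c r := Metric.ball_subset_ball (by linarith)
  have h1 : ∀ y ∈ Metric.ball c (r / 2), ‖fderiv ℝ f y‖ ≤ L₁ := by
    intro y hy
    have hs : Metric.ball y (r / 2) ⊆ Metric.ball c r := by
      refine Metric.ball_subset_ball' ?_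
      have : dist y c < r / 2 := hy
      linarith
    exact norm_fderiv_le_of_norm_sub_snd_le (by positivity) (fun z hz => hf z (hs hz))
      (fun z hz => hf' z (hs hz)) (fun z hz => hM z (hs hz)) (fun z hz => hK z (hs hz))
  have hc' : c ∈ Metric.ball c (r / 2) := Metric.mem_ball_self (by positivity)
  have hL0 : 0 ≤ L₁ := (norm_nonneg _).trans (h1 c hc')
  have h2 : ‖fderiv ℝ (fderiv ℝ f) c‖ ≤ 2 * (2 * L₁ + K * r) / (r / 2) := by
    refine opNorm_le_of_norm_apply_le_on_ball (by positivity) (by positivity) fun w hw => ?_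
    have hw' : c + w ∈ Metric.ball c (r / 2) := by simpa using hw
    have hmv := (convex_ball c r).norm_image_sub_le_of_norm_fderiv_le' hf' hK hc (hsub hw')
    rw [add_sub_cancel_left] at hmv
    have h4 : K * ‖w‖ ≤ K * r := by gcongr; linarith
    calc ‖fderiv ℝ (fderiv ℝ f) c w‖
        = ‖(fderiv ℝ f (c + w) - fderiv ℝ f c)
          - (fderiv ℝ f (c + w) - fderiv ℝ f c - fderiv ℝ (fderiv ℝ f) c w)‖ := by
          congr 1; abel
      _ ≤ _ := by
          linarith [norm_sub_le (fderiv ℝ f (c + w) - fderiv ℝ f c)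
            (fderiv ℝ f (c + w) - fderiv ℝ f c - fderiv ℝ (fderiv ℝ f) c w),
            norm_sub_le (fderiv ℝ f (c + w)) (fderiv ℝ f c), h1 _ hw', h1 c hc']
  intro y hy
  refine ⟨(h1 y hy).trans (le_max_left _ _), le_trans ?_ (le_max_right _ _)⟩
  calc ‖fderiv ℝ (fderiv ℝ f) y‖
      = ‖(fderiv ℝ (fderiv ℝ f) y - fderiv ℝ (fderiv ℝ f) c) + fderiv ℝ (fderiv ℝ f) c‖ := by
        congr 1; abel
    _ ≤ L₂ := by
        linarith [norm_add_le (fderiv ℝ (fderiv ℝ f) y - fderiv ℝ (fderiv ℝ f) c)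
          (fderiv ℝ (fderiv ℝ f) c), hK y (hsub hy)]

end Interpolation


section ParametricIntegral

variable {E G Z : Type*} [NormedAddCommGroup E] [NormedSpace ℝ E]
  [NormedAddCommGroup G] [NormedSpace ℝ G]
  [MeasurableSpace Z] {μ : Measure Z}

theorem aestronglyMeasurable_fderiv_apply {g : E → Z → G} {x : E}
    (hmeas : ∀ᶠ y in nhds x, AEStronglyMeasurable (g y) μ)
    (hdiff : ∀ᵐ z ∂μ, DifferentiableAt ℝ (fun y => g y z) x) (v : E) :
    AEStronglyMeasurable (fun z => fderiv ℝ (fun y => g y z) x v) μ := by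
  have hx := hmeas.self_of_nhds
  have hlim : Filter.Tendsto (fun s : ℝ => x + s • v) (nhdsWithin 0 {0}ᶜ) (nhds x) := by
    have : ContinuousAt (fun s : ℝ => x + s • v) 0 := by fun_prop
    simpa [ContinuousAt] using this.tendsto.mono_left nhdsWithin_le_nhds
  have hev := hlim.eventually hmeas
  classical
  let u : ℝ → Z → G := fun s =>
    if AEStronglyMeasurable (g (x + s • v)) μ then fun z => s⁻¹ • (g (x + s • v) z - g x z) else 0
  refine aestronglyMeasurable_of_tendsto_ae (f := u) (nhdsWithin (0 : ℝ) {0}ᶜ) ?_ ?_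
  · intro s
    by_cases h : AEStronglyMeasurable (g (x + s • v)) μ
    · simp only [u, h, if_true]
      exact (h.sub hx).const_smul s⁻¹
    · simpa [u, h] using aestronglyMeasurable_zero
  · filter_upwards [hdiff] with z hz
    have h1 := hz.hasFDerivAt.hasLineDerivAt v
    refine h1.tendsto_slope_zero.congr' ?_
    filter_upwards [hev] with s hs
    simp [u, hs]

theorem aestronglyMeasurable_fderiv_of_eventually [FiniteDimensional ℝ E]
    {g : E → Z → G} {x : E}
    (hmeas : ∀ᶠ y in nhds x, AEStronglyMeasurable (g y) μ)
    (hdiff : ∀ᵐ z ∂μ, DifferentiableAt ℝ (fun y => g y z) x) :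
    AEStronglyMeasurable (fun z => fderiv ℝ (fun y => g y z) x) μ := by
  let b := Module.finBasis ℝ E
  have e : (fun z => fderiv ℝ (fun y => g y z) x) = fun z =>
      ∑ i, ContinuousLinearMap.smulRightL ℝ E G (b.coord i).toContinuousLinearMap
        (fderiv ℝ (fun y => g y z) x (b i)) := by
    ext z w
    conv_lhs => rw [← b.sum_repr w, map_sum]
    simp [-Module.Basis.sum_repr]
  rw [e]
  refine Finset.aestronglyMeasurable_fun_sum _ fun i _ => ?_
  exact (ContinuousLinearMap.continuous _).comp_aestronglyMeasurable
    (aestronglyMeasurable_fderiv_apply hmeas hdiff (b i))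

theorem hasFDerivAt_integral_of_norm_fderiv_le [FiniteDimensional ℝ E] [IsFiniteMeasure μ] {g : E → Z → G} {s : Set E}
    {M : ℝ} (hs : IsOpen s) (hmeas : ∀ y ∈ s, AEStronglyMeasurable (g y) μ)
    (hdiff : ∀ᵐ z ∂μ, ∀ y ∈ s, DifferentiableAt ℝ (fun y => g y z) y)
    (hM : ∀ᵐ z ∂μ, ∀ y ∈ s, ‖g y z‖ ≤ M)
    (hM' : ∀ᵐ z ∂μ, ∀ y ∈ s, ‖fderiv ℝ (fun y => g y z) y‖ ≤ M) {x : E} (hx : x ∈ s) :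
    Integrable (fun z => fderiv ℝ (fun y => g y z) x) μ ∧
      HasFDerivAt (fun y => ∫ z, g y z ∂μ) (∫ z, fderiv ℝ (fun y => g y z) x ∂μ) x := by
  have hme : ∀ᶠ y in nhds x, AEStronglyMeasurable (g y) μ := by
    filter_upwards [hs.mem_nhds hx] with y hy using hmeas y hy
  have hm' := aestronglyMeasurable_fderiv_of_eventually hme (hdiff.mono fun z hz => hz x hx)
  refine ⟨.of_bound hm' M (hM'.mono fun z hz => hz x hx), ?_⟩
  exact hasFDerivAt_integral_of_dominated_of_fderiv_le (bound := fun _ => M) (hs.mem_nhds hx) hme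
    (.of_bound (hmeas x hx) M (hM.mono fun z hz => hz x hx)) hm' hM' (integrable_const M)
    (hdiff.mono fun z hz y hy => (hz y hy).hasFDerivAt)

theorem fderiv_fderiv_integral_apply [CompleteSpace G] [FiniteDimensional ℝ E]
    [IsFiniteMeasure μ] {g : E → Z → G}
    {s : Set E} {M : ℝ} (hs : IsOpen s) (hmeas : ∀ y ∈ s, AEStronglyMeasurable (g y) μ)
    (hsm : ∀ᵐ z ∂μ, ContDiffOn ℝ 2 (fun y => g y z) s)
    (hM : ∀ᵐ z ∂μ, ∀ y ∈ s, ‖g y z‖ ≤ M)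
    (hM' : ∀ᵐ z ∂μ, ∀ y ∈ s, ‖fderiv ℝ (fun y => g y z) y‖ ≤ M)
    (hM'' : ∀ᵐ z ∂μ, ∀ y ∈ s, ‖fderiv ℝ (fderiv ℝ (fun y => g y z)) y‖ ≤ M)
    {x : E} (hx : x ∈ s) (v w : E) :
    fderiv ℝ (fun y => fderiv ℝ (fun y => ∫ z, g y z ∂μ) y v) x w =
      ∫ z, fderiv ℝ (fun y => fderiv ℝ (fun y => g y z) y v) x w ∂μ := by
  have hd : ∀ᵐ z ∂μ, ∀ y ∈ s, DifferentiableAt ℝ (fun y => g y z) y := by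
    filter_upwards [hsm] with z hz y hy
    exact ((hz y hy).contDiffAt (hs.mem_nhds hy)).differentiableAt (by norm_num)
  have hd2 : ∀ᵐ z ∂μ, ∀ y ∈ s, DifferentiableAt ℝ (fderiv ℝ (fun y => g y z)) y := by
    filter_upwards [hsm] with z hz y hy
    exact (((hz y hy).contDiffAt (hs.mem_nhds hy)).fderiv_right (m := 1) (by norm_num)
      ).differentiableAt (by norm_num)
  have h1 := fun y (hy : y ∈ s) =>
    hasFDerivAt_integral_of_norm_fderiv_le hs hmeas hd hM hM' hy
  have e1 : (fun y => fderiv ℝ (fun y => ∫ z, g y z ∂μ) y v) =ᶠ[nhds x]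
      fun y => ∫ z, fderiv ℝ (fun y => g y z) y v ∂μ := by
    filter_upwards [hs.mem_nhds hx] with y hy
    rw [(h1 y hy).2.fderiv, ContinuousLinearMap.integral_apply (h1 y hy).1]
  rw [e1.fderiv_eq]
  have h2 := hasFDerivAt_integral_of_norm_fderiv_le (μ := μ)
    (g := fun y z => fderiv ℝ (fun y => g y z) y v) (M := M * ‖v‖) hs
    (fun y hy => (h1 y hy).1.aestronglyMeasurable.apply_continuousLinearMap v)
    (by filter_upwards [hd2] with z hz y hy using (hz y hy).clm_apply (by fun_prop))
    (by
      filter_upwards [hM'] with z hz y hy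
      exact (ContinuousLinearMap.le_opNorm _ _).trans (by gcongr; exact hz y hy))
    (by
      filter_upwards [hM'', hd2] with z hz hz2 y hy
      rw [((hz2 y hy).hasFDerivAt.clm_apply (hasFDerivAt_const v y)).fderiv]
      refine ContinuousLinearMap.opNorm_le_bound _ ?_ fun u => ?_
      · exact mul_nonneg ((norm_nonneg (fderiv ℝ (fderiv ℝ fun y => g y z) y)).trans (hz y hy))
          (norm_nonneg _)
      · simp only [ContinuousLinearMap.comp_zero, zero_add, ContinuousLinearMap.flip_apply]
        refine (ContinuousLinearMap.le_opNorm₂ _ _ _).trans ?_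
        rw [mul_right_comm]
        gcongr
        exact hz y hy) hx
  rw [h2.2.fderiv, ContinuousLinearMap.integral_apply h2.1]

end ParametricIntegral


section Convex

variable {E : Type*} [NormedAddCommGroup E] [NormedSpace ℝ E] {f : E → ℝ} {U : Set E} {x : E}

theorem fderiv_fderiv_self_nonneg_of_convexOn (hU : IsOpen U) (hf : ContDiffOn ℝ 2 f U)
    (hc : ConvexOn ℝ U f) (hx : x ∈ U) (u : E) : 0 ≤ fderiv ℝ (fderiv ℝ f) x u u := by
  let L : ℝ →ᵃ[ℝ] E := AffineMap.lineMap x (x + u)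
  have hL : ∀ s, HasDerivAt L u s := fun s => by
    simpa using (AffineMap.hasDerivAt_lineMap (a := x) (b := x + u) (x := s))
  have hLc : Continuous L := continuous_iff_continuousAt.2 fun s => (hL s).continuousAt
  have hL0 : L 0 = x := AffineMap.lineMap_apply_zero _ _
  have hS : IsOpen (L ⁻¹' U) := hU.preimage hLc
  have h0 : (0 : ℝ) ∈ L ⁻¹' U := by simpa [hL0] using hx
  have hfa : ∀ y ∈ U, ContDiffAt ℝ 2 f y := fun y hy => (hf y hy).contDiffAt (hU.mem_nhds hy)
  have hk : ∀ s ∈ L ⁻¹' U, HasDerivAt (f ∘ L) (fderiv ℝ f (L s) u) s := fun s hs =>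
    ((hfa _ hs).differentiableAt (by norm_num)).hasFDerivAt.comp_hasDerivAt s (hL s)
  have hmono := (hc.comp_affineMap L).monotoneOn_deriv fun s hs => (hk s hs).differentiableAt
  have h2 : HasDerivAt (fun s => fderiv ℝ f (L s) u) (fderiv ℝ (fderiv ℝ f) x u u) 0 := by
    have h3 : HasFDerivAt (fderiv ℝ f) (fderiv ℝ (fderiv ℝ f) x) (L 0) := by
      rw [hL0]
      exact (((hfa x hx).fderiv_right (m := 1) (by norm_num)).differentiableAt
        (by norm_num)).hasFDerivAt
    simpa using (h3.comp_hasDerivAt (0 : ℝ) (hL 0)).clm_apply (hasDerivAt_const (0 : ℝ) u)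
  have h4 : HasDerivAt (deriv (f ∘ L)) (fderiv ℝ (fderiv ℝ f) x u u) 0 := by
    refine h2.congr_of_eventuallyEq ?_
    filter_upwards [hS.mem_nhds h0] with s hs using (hk s hs).deriv
  rw [← h4.deriv, ← derivWithin_of_isOpen hS h0]
  exact hmono.derivWithin_nonneg

theorem apply_eq_zero_of_apply_self_eq_zero {B : E →L[ℝ] E →L[ℝ] ℝ}
    (hsymm : ∀ u w, B u w = B w u) (hpos : ∀ u, 0 ≤ B u u) {v : E} (hv : B v v = 0) (u : E) :
    B v u = 0 := by
  have h : ∀ s : ℝ, 0 ≤ B u u * (s * s) + 2 * B v u * s + 0 := fun s => by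
    have := hpos (v + s • u)
    simp only [map_add, map_smul, _root_.add_apply, _root_.smul_apply, smul_eq_mul, hv, hsymm u v] at this
    linarith
  have := discrim_le_zero h
  rw [discrim] at this
  nlinarith [sq_nonneg (B v u)]

/-- Where the Hessian of a convex function degenerates in the direction `v`, so do all third
derivatives involving `v` twice. -/
theorem fderiv_fderiv_fderiv_eq_zero_of_convexOn (hU : IsOpen U) (hf : ContDiffOn ℝ 3 f U)
    (hc : ConvexOn ℝ U f) (hx : x ∈ U) {v : E} (hv : fderiv ℝ (fderiv ℝ f) x v v = 0) (u : E) :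
    fderiv ℝ (fderiv ℝ (fderiv ℝ f)) x v v u = 0 := by
  have hf2 : ContDiffOn ℝ 2 f U := hf.of_le (by norm_num)
  have hfa : ∀ y ∈ U, ContDiffAt ℝ 3 f y := fun y hy => (hf y hy).contDiffAt (hU.mem_nhds hy)
  have hD : ContDiffAt ℝ 2 (fderiv ℝ f) x := (hfa x hx).fderiv_right (by norm_num)
  have hD2 : HasFDerivAt (fderiv ℝ (fderiv ℝ f)) (fderiv ℝ (fderiv ℝ (fderiv ℝ f)) x) x :=
    ((hD.fderiv_right (m := 1) (by norm_num)).differentiableAt (by norm_num)).hasFDerivAt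
  have happ : ∀ a b : E, HasFDerivAt (fun y => fderiv ℝ (fderiv ℝ f) y a b)
      (((fderiv ℝ (fderiv ℝ (fderiv ℝ f)) x).flip a).flip b) x := fun a b => by
    simpa using (hD2.clm_apply (hasFDerivAt_const a x)).clm_apply (hasFDerivAt_const b x)
  have hsymm : ∀ y ∈ U, ∀ a b, fderiv ℝ (fderiv ℝ f) y a b = fderiv ℝ (fderiv ℝ f) y b a :=
    fun y hy => ((hfa y hy).of_le (by norm_num : (2 : WithTop ℕ∞) ≤ 3)).isSymmSndFDerivAt
      (by simp)
  have hmin : IsLocalMin (fun y => fderiv ℝ (fderiv ℝ f) y v v) x := by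
    filter_upwards [hU.mem_nhds hx] with y hy
    rw [hv]
    exact fderiv_fderiv_self_nonneg_of_convexOn hU hf2 hc hy v
  have h0 := hmin.hasFDerivAt_eq_zero (happ v v)
  have h1 : fderiv ℝ (fderiv ℝ (fderiv ℝ f)) x u v v = 0 := by
    simpa using DFunLike.congr_fun h0 u
  have h2 : fderiv ℝ (fderiv ℝ (fderiv ℝ f)) x v v u =
      fderiv ℝ (fderiv ℝ (fderiv ℝ f)) x v u v := by
    have e : (fun y => fderiv ℝ (fderiv ℝ f) y v u) =ᶠ[nhds x]
        fun y => fderiv ℝ (fderiv ℝ f) y u v := by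
      filter_upwards [hU.mem_nhds hx] with y hy using hsymm y hy v u
    have := e.fderiv_eq (𝕜 := ℝ)
    rw [(happ v u).fderiv, (happ u v).fderiv] at this
    simpa using DFunLike.congr_fun this v
  have h3 : fderiv ℝ (fderiv ℝ (fderiv ℝ f)) x v u = fderiv ℝ (fderiv ℝ (fderiv ℝ f)) x u v :=
    hD.isSymmSndFDerivAt (by simp) v u
  rw [h2, h3, h1]

/-- The second directional derivative of the compensated jump `f (y + ψ y) - f y - Df(y) ψ(y)`. -/
theorem fderiv_fderiv_compensated_apply {ψ : E → E} (hf : ContDiffAt ℝ 3 f x)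
    (hf' : ContDiffAt ℝ 2 f (x + ψ x)) (hψ : ContDiffAt ℝ 2 ψ x) (v : E) :
    fderiv ℝ (fun y => fderiv ℝ (fun y => f (y + ψ y) - f y - fderiv ℝ f y (ψ y)) y v) x v =
      fderiv ℝ (fderiv ℝ f) (x + ψ x) (v + fderiv ℝ ψ x v) (v + fderiv ℝ ψ x v)
        + fderiv ℝ f (x + ψ x) (fderiv ℝ (fderiv ℝ ψ) x v v)
        - fderiv ℝ (fderiv ℝ f) x v v
        - (fderiv ℝ (fderiv ℝ (fderiv ℝ f)) x v v (ψ x)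
          + 2 * fderiv ℝ (fderiv ℝ f) x v (fderiv ℝ ψ x v)
          + fderiv ℝ f x (fderiv ℝ (fderiv ℝ ψ) x v v)) := by
  have hp : ContinuousAt (fun y => y + ψ y) x := continuousAt_id.add hψ.continuousAt
  have hev : (fun y => fderiv ℝ (fun y => f (y + ψ y) - f y - fderiv ℝ f y (ψ y)) y v) =ᶠ[nhds x]
      fun y => fderiv ℝ f (y + ψ y) (v + fderiv ℝ ψ y v) - fderiv ℝ f y v
        - (fderiv ℝ (fderiv ℝ f) y v (ψ y) + fderiv ℝ f y (fderiv ℝ ψ y v)) := by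
    filter_upwards [hp.eventually (hf'.eventually (by norm_num)), hf.eventually (by norm_num),
      hψ.eventually (by norm_num)] with y h1 h2 h3
    have d1 := (h1.differentiableAt (by norm_num)).hasFDerivAt
    have d2 := (h2.differentiableAt (by norm_num)).hasFDerivAt
    have d3 := (h3.differentiableAt (by norm_num)).hasFDerivAt
    have d4 := ((h2.fderiv_right (m := 2) (by norm_num)).differentiableAt
      (by norm_num)).hasFDerivAt
    have d5 := (d1.comp y ((hasFDerivAt_id y).add d3)).sub d2 |>.sub (d4.clm_apply d3)
    have d6 := congrArg (fun A : E →L[ℝ] ℝ => A v) d5.fderiv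
    refine Eq.trans d6 ?_
    simp [add_comm]
  rw [hev.fderiv_eq]
  have d1 := ((hf'.fderiv_right (m := 1) (by norm_num)).differentiableAt (by norm_num)).hasFDerivAt
  have dp := (hasFDerivAt_id x).add (hψ.differentiableAt (by norm_num)).hasFDerivAt
  have d2 := ((hf.fderiv_right (m := 2) (by norm_num)).differentiableAt (by norm_num)).hasFDerivAt
  have d3 := (((hf.fderiv_right (m := 2) (by norm_num)).fderiv_right (m := 1)
    (by norm_num)).differentiableAt (by norm_num)).hasFDerivAt
  have d4 := ((hψ.fderiv_right (m := 1) (by norm_num)).differentiableAt (by norm_num)).hasFDerivAt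
  have d5 := (hψ.differentiableAt (by norm_num)).hasFDerivAt
  have d4v := d4.clm_apply (hasFDerivAt_const v x)
  have key := ((d1.comp x dp).clm_apply (d4v.const_add v)).sub
    (d2.clm_apply (hasFDerivAt_const v x)) |>.sub
    (((d3.clm_apply (hasFDerivAt_const v x)).clm_apply d5).add (d2.clm_apply d4v))
  have d6 := congrArg (fun A : E →L[ℝ] ℝ => A v) key.fderiv
  refine Eq.trans d6 ?_
  simp
  ring

end Convex


section UniformBounds

variable {E F G : Type*} [NormedAddCommGroup E] [NormedSpace ℝ E]
  [NormedAddCommGroup F] [NormedSpace ℝ F] [NormedAddCommGroup G] [NormedSpace ℝ G]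

theorem contDiffAt_of_contDiffOn_nat {f : E → F} {s : Set E} {x : E} {j n : ℕ} (hs : IsOpen s)
    (hx : x ∈ s) (hf : ContDiffOn ℝ n f s) (hj : j ≤ n) : ContDiffAt ℝ j f x :=
  (hf.contDiffAt (hs.mem_nhds hx)).of_le (by exact_mod_cast hj)

theorem norm_iteratedFDeriv_two (f : E → F) (x : E) :
    ‖iteratedFDeriv ℝ 2 f x‖ = ‖fderiv ℝ (fderiv ℝ f) x‖ := by
  rw [← norm_iteratedFDeriv_one, norm_iteratedFDeriv_fderiv]

theorem ContDiffOn.exists_norm_iteratedFDeriv_le {n : ℕ} {f : E → F} {U C : Set E}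
    (hf : ContDiffOn ℝ n f U) (hU : IsOpen U) (hC : IsCompact C) (hCU : C ⊆ U) :
    ∃ A : ℝ, 0 ≤ A ∧ ∀ k ≤ n, ∀ x ∈ C, ‖iteratedFDeriv ℝ k f x‖ ≤ A := by
  have h : ∀ k, ∃ B : ℝ, k ≤ n → ∀ x ∈ C, ‖iteratedFDeriv ℝ k f x‖ ≤ B := by
    intro k
    by_cases hk : k ≤ n
    · obtain ⟨B, hB⟩ := hC.exists_bound_of_continuousOn
        ((hf.continuousOn_iteratedFDerivWithin (m := k) (by exact_mod_cast hk)
          hU.uniqueDiffOn).mono hCU)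
      refine ⟨B, fun _ x hx => ?_⟩
      rw [← iteratedFDerivWithin_of_isOpen k hU (hCU hx)]
      exact hB x hx
    · exact ⟨0, fun h => absurd h hk⟩
  choose B hB using h
  refine ⟨∑ k ∈ Finset.range (n + 1), |B k|, by positivity, fun k hk x hx => ?_⟩
  calc ‖iteratedFDeriv ℝ k f x‖ ≤ |B k| := (hB k hk x hx).trans (le_abs_self _)
    _ ≤ _ := Finset.single_le_sum (f := fun k => |B k|) (fun _ _ => abs_nonneg _)
      (Finset.mem_range.2 (Nat.lt_succ_of_le hk))

theorem norm_iteratedFDeriv_comp_le_of_isOpen {f : F → G} {p : E → F} {U : Set F} {s : Set E}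
    {n : ℕ} (hU : IsOpen U) (hs : IsOpen s) (hf : ContDiffOn ℝ n f U) (hp : ContDiffOn ℝ n p s)
    (hps : MapsTo p s U) {x : E} (hx : x ∈ s) {A P : ℝ} (hP : 1 ≤ P)
    (hA : ∀ k ≤ n, ‖iteratedFDeriv ℝ k f (p x)‖ ≤ A)
    (hpP : ∀ k ≤ n, 1 ≤ k → ‖iteratedFDeriv ℝ k p x‖ ≤ P) {k : ℕ} (hk : k ≤ n) :
    ‖iteratedFDeriv ℝ k (fun y => f (p y)) x‖ ≤ n.factorial * A * P ^ n := by
  have hA0 : 0 ≤ A := (norm_nonneg _).trans (hA 0 (Nat.zero_le _))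
  have h := norm_iteratedFDerivWithin_comp_le (n := k) hf hp (by exact_mod_cast hk)
    hU.uniqueDiffOn hs.uniqueDiffOn hps hx (C := A) (D := P)
    (fun i hi => by
      rw [iteratedFDerivWithin_of_isOpen i hU (hps hx)]
      exact hA i (hi.trans hk))
    (fun i hi hik => by
      rw [iteratedFDerivWithin_of_isOpen i hs hx]
      exact (hpP i (hik.trans hk) hi).trans (le_self_pow₀ hP (by omega)))
  rw [iteratedFDerivWithin_of_isOpen k hs hx] at h
  refine h.trans ?_
  gcongr

theorem norm_iteratedFDeriv_clm_apply_le_of_isOpen {f : E → F →L[ℝ] G} {g : E → F} {s : Set E}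
    {n : ℕ} (hs : IsOpen s) (hf : ContDiffOn ℝ n f s) (hg : ContDiffOn ℝ n g s) {x : E}
    (hx : x ∈ s) {A B : ℝ} (hA : ∀ k ≤ n, ‖iteratedFDeriv ℝ k f x‖ ≤ A)
    (hB : ∀ k ≤ n, ‖iteratedFDeriv ℝ k g x‖ ≤ B) {k : ℕ} (hk : k ≤ n) :
    ‖iteratedFDeriv ℝ k (fun y => f y (g y)) x‖ ≤ 2 ^ n * A * B := by
  have hA0 : 0 ≤ A := (norm_nonneg _).trans (hA 0 (Nat.zero_le _))
  have hB0 : 0 ≤ B := (norm_nonneg _).trans (hB 0 (Nat.zero_le _))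
  have h := norm_iteratedFDerivWithin_clm_apply (n := k) hf hg hs.uniqueDiffOn hx
    (by exact_mod_cast hk)
  rw [iteratedFDerivWithin_of_isOpen k hs hx] at h
  calc _ ≤ _ := h
    _ ≤ ∑ i ∈ Finset.range (k + 1), (k.choose i : ℝ) * A * B := by
      refine Finset.sum_le_sum fun i hi => ?_
      have hik : i ≤ k := Nat.lt_succ_iff.1 (Finset.mem_range.1 hi)
      rw [iteratedFDerivWithin_of_isOpen i hs hx, iteratedFDerivWithin_of_isOpen (k - i) hs hx]
      gcongr
      · exact hA i (hik.trans hk)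
      · exact hB (k - i) ((Nat.sub_le _ _).trans hk)
    _ = 2 ^ k * A * B := by
      rw [← Finset.sum_mul, ← Finset.sum_mul]
      exact_mod_cast congrArg (fun m : ℕ => (m : ℝ) * A * B) (Nat.sum_range_choose k)
    _ ≤ 2 ^ n * A * B := by gcongr; norm_num

theorem contDiffOn_compensated {f : E → F} {ψ : E → E} {U s : Set E} (hU : IsOpen U)
    (hsU : s ⊆ U) (hf : ContDiffOn ℝ 3 f U) (hψ : ContDiffOn ℝ 2 ψ s)
    (hψU : MapsTo (fun y => y + ψ y) s U) :
    ContDiffOn ℝ 2 (fun y => f (y + ψ y) - f y - fderiv ℝ f y (ψ y)) s := by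
  have hf2 : ContDiffOn ℝ 2 f U := hf.of_le (by norm_num)
  refine ((hf2.comp (contDiffOn_id.add hψ) hψU).sub (hf2.mono hsU)).sub ?_
  exact ((hf.fderiv_of_isOpen hU (m := 2) (by norm_num)).mono hsU).clm_apply hψ

/-- Uniform `C²` bounds for the compensated jump, over all jump functions `ψ` with prescribed
`C²` bounds and landing points in a fixed compact set. -/
theorem exists_norm_iteratedFDeriv_compensated_le {f : E → F} {U s C : Set E} (hU : IsOpen U)
    (hs : IsOpen s) (hC : IsCompact C) (hsC : s ⊆ C) (hCU : C ⊆ U) (hf : ContDiffOn ℝ 3 f U)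
    (M : ℝ) :
    ∃ A : ℝ, ∀ ψ : E → E, ContDiffOn ℝ 2 ψ s → MapsTo (fun y => y + ψ y) s C →
      (∀ k ≤ 2, ∀ y ∈ s, ‖iteratedFDeriv ℝ k ψ y‖ ≤ M) →
      ∀ k ≤ 2, ∀ y ∈ s,
        ‖iteratedFDeriv ℝ k (fun y => f (y + ψ y) - f y - fderiv ℝ f y (ψ y)) y‖ ≤ A := by
  have hf2 : ContDiffOn ℝ (2 : ℕ) f U := hf.of_le (by norm_num)
  have hDf : ContDiffOn ℝ (2 : ℕ) (fderiv ℝ f) U := hf.fderiv_of_isOpen hU (by norm_num)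
  obtain ⟨A₀, -, hA₀⟩ := (contDiffOn_id (n := (2 : ℕ)) (𝕜 := ℝ) (s := U) (E := E)
    ).exists_norm_iteratedFDeriv_le hU hC hCU
  obtain ⟨A₁, -, hA₁⟩ := hf2.exists_norm_iteratedFDeriv_le hU hC hCU
  obtain ⟨A₂, -, hA₂⟩ := hDf.exists_norm_iteratedFDeriv_le hU hC hCU
  set P := max 1 (A₀ + M) with hP
  refine ⟨(2 : ℕ).factorial * A₁ * P ^ 2 + A₁ + 2 ^ 2 * A₂ * M,
    fun ψ hψ hψC hψM k hk y hy => ?_⟩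
  have hψ' : ContDiffOn ℝ (2 : ℕ) ψ s := hψ
  have hpC : ContDiffOn ℝ (2 : ℕ) (fun y => y + ψ y) s := contDiffOn_id.add hψ'
  have hcomp : ContDiffOn ℝ (2 : ℕ) (fun y => f (y + ψ y)) s :=
    hf2.comp hpC fun z hz => hCU (hψC hz)
  have hlin : ContDiffOn ℝ (2 : ℕ) (fun y => fderiv ℝ f y (ψ y)) s :=
    (hDf.mono (hsC.trans hCU)).clm_apply hψ'
  have hfs : ContDiffOn ℝ (2 : ℕ) f s := hf2.mono (hsC.trans hCU)
  have b1 : ‖iteratedFDeriv ℝ k (fun y => f (y + ψ y)) y‖ ≤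
      (2 : ℕ).factorial * A₁ * P ^ 2 := by
    refine norm_iteratedFDeriv_comp_le_of_isOpen (n := 2) hU hs hf2 hpC
      (fun z hz => hCU (hψC hz)) hy (le_max_left _ _) (fun j hj => hA₁ j hj _ (hψC hy))
      (fun j hj _ => ?_) hk
    have e := iteratedFDeriv_add_apply (contDiffAt_of_contDiffOn_nat hs hy contDiffOn_id hj)
      (contDiffAt_of_contDiffOn_nat hs hy hψ' hj)
    refine le_trans (le_of_eq_of_le (congrArg norm e) (norm_add_le _ _)) ?_
    exact (add_le_add (hA₀ j hj y (hsC hy)) (hψM j hj y hy)).trans (le_max_right _ _)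
  have b2 := hA₁ k hk y (hsC hy)
  have b3 := norm_iteratedFDeriv_clm_apply_le_of_isOpen (n := 2) hs
    (hDf.mono (hsC.trans hCU)) hψ' hy (fun j hj => hA₂ j hj y (hsC hy))
    (fun j hj => hψM j hj y hy) hk
  have d1 := contDiffAt_of_contDiffOn_nat hs hy hcomp hk
  have d2 := contDiffAt_of_contDiffOn_nat hs hy hfs hk
  have d3 := contDiffAt_of_contDiffOn_nat hs hy hlin hk
  have e1 := iteratedFDeriv_sub_apply d1 d2
  have e2 := iteratedFDeriv_sub_apply (d1.sub d2) d3
  refine le_trans (le_of_eq_of_le (congrArg norm e2) (norm_sub_le _ _)) (add_le_add ?_ b3)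
  exact le_trans (le_of_eq_of_le (congrArg norm e1) (norm_sub_le _ _)) (add_le_add b1 b2)

end UniformBounds

section JumpKernel

variable {n : ℕ} {T : ℝ}

theorem isOpen_posOrth (n : ℕ) : IsOpen (posOrth n) := by
  simp only [posOrth, Set.ofPred_forall]
  exact isOpen_iInter_of_finite fun i => isOpen_lt continuous_const (continuous_apply i)

theorem add_jump_mem_posOrth (K : JumpKernel n T) {y : Fin n → ℝ} (hy : y ∈ posOrth n) {t : ℝ}
    (ht : t ∈ Icc (0 : ℝ) T) {z : ℝ} (hz : z ∈ Icc (0 : ℝ) 1) :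
    y + K.φ y t z ∈ posOrth n := by
  obtain ⟨γ₀, hγ, hlow⟩ := K.lower
  intro i
  have h1 := hlow y hy t ht z hz i
  have h2 := mul_pos (by linarith : 0 < 1 + γ₀) (hy i)
  simp only [Pi.add_apply]
  linarith

theorem norm_fderiv_fderiv_sub_le {E F : Type*} [NormedAddCommGroup E] [NormedSpace ℝ E]
    [NormedAddCommGroup F] [NormedSpace ℝ F] (f : E → F) (x y : E) :
    ‖fderiv ℝ (fderiv ℝ f) y - fderiv ℝ (fderiv ℝ f) x‖ ≤
      dist (iteratedFDeriv ℝ 2 f y) (iteratedFDeriv ℝ 2 f x) := by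
  rw [dist_eq_norm]
  refine ContinuousLinearMap.opNorm_le_bound₂ _ (norm_nonneg _) fun u w => ?_
  have h := (iteratedFDeriv ℝ 2 f y - iteratedFDeriv ℝ 2 f x).le_opNorm ![u, w]
  rw [_root_.sub_apply, iteratedFDeriv_two_apply, iteratedFDeriv_two_apply] at h
  simpa [Fin.prod_univ_two, mul_assoc] using h

/-- The jumps are `C²`-bounded near every point, uniformly in the mark `z`, and they move a
neighbourhood of the point into a compact subset of the orthant. -/
theorem JumpKernel.exists_uniform_bounds (K : JumpKernel n T) {x : Fin n → ℝ}
    (hx : x ∈ posOrth n) {t : ℝ} (ht : t ∈ Icc (0 : ℝ) T) :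
    ∃ s C : Set (Fin n → ℝ), ∃ M : ℝ, IsOpen s ∧ x ∈ s ∧ IsCompact C ∧ s ⊆ C ∧ C ⊆ posOrth n ∧
      ∀ z ∈ Icc (0 : ℝ) 1, MapsTo (fun y => y + K.φ y t z) s C ∧
        ∀ k ≤ 2, ∀ y ∈ s, ‖iteratedFDeriv ℝ k (fun y => K.φ y t z) y‖ ≤ M := by
  obtain ⟨γ₀, hγ, hlow⟩ := K.lower
  obtain ⟨D, hD, hbd⟩ := K.bound
  obtain ⟨α, -, -, hα⟩ := K.holder2
  obtain ⟨S, hS, hSU, Ch, hCh⟩ := hα t ht x hx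
  have hbox : {y : Fin n → ℝ | ∀ i, x i / 2 < y i ∧ y i < 2 * x i} ∈ nhds x := by
    refine IsOpen.mem_nhds ?_ fun i => ⟨by linarith [hx i], by linarith [hx i]⟩
    simp only [Set.ofPred_forall]
    exact isOpen_iInter_of_finite fun i =>
      (isOpen_lt continuous_const (continuous_apply i)).inter
        (isOpen_lt (continuous_apply i) continuous_const)
  obtain ⟨r, hr, hball⟩ := Metric.mem_nhds_iff.1 (Filter.inter_mem hbox hS)
  have hjump : ∀ y ∈ Metric.ball x r, ∀ z ∈ Icc (0 : ℝ) 1, ∀ i,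
      |K.φ y t z i| ≤ √D * y i := by
    intro y hy z hz i
    have hy' := hSU (hball hy).2
    refine abs_le_of_sq_le_sq ?_ (mul_nonneg (Real.sqrt_nonneg _) (hy' i).le)
    rw [mul_pow, Real.sq_sqrt hD.le]
    exact hbd y hy' t ht z hz i
  have hjump' : ∀ z ∈ Icc (0 : ℝ) 1, ∀ y ∈ Metric.ball x r, ‖K.φ y t z‖ ≤ √D * (2 * ‖x‖) := by
    intro z hz y hy
    refine (pi_norm_le_iff_of_nonneg (by positivity)).2 fun i => ?_
    refine (hjump y hy z hz i).trans ?_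
    have := (hball hy).1 i
    have h2 : x i ≤ ‖x‖ := (le_abs_self _).trans (norm_le_pi_norm x i)
    gcongr
    linarith
  obtain ⟨L, hL⟩ := exists_norm_fderiv_le_of_norm_sub_snd_le (F := Fin n → ℝ) x
    (M := √D * (2 * ‖x‖)) (K := Ch * r ^ (α : ℝ)) hr
  have hsub : Metric.ball x (r / 2) ⊆ Metric.ball x r := Metric.ball_subset_ball (by linarith)
  set m := min 1 (1 + γ₀) with hm
  have hm0 : 0 < m := lt_min one_pos (by linarith)
  refine ⟨Metric.ball x (r / 2), Icc (fun i => m * (x i / 2)) (fun i => (1 + √D) * (2 * x i)),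
    max (√D * (2 * ‖x‖)) L, Metric.isOpen_ball, Metric.mem_ball_self (by positivity),
    isCompact_Icc, ?_, ?_, ?_⟩
  · intro y hy
    have hb := (hball (hsub hy)).1
    refine ⟨fun i => ?_, fun i => ?_⟩
    · have h1 : m * (x i / 2) ≤ 1 * (x i / 2) := by
        have := hx i
        gcongr
        exact min_le_left _ _
      change m * (x i / 2) ≤ y i
      linarith [hb i]
    · have h1 : 0 ≤ √D * (2 * x i) :=
        mul_nonneg (Real.sqrt_nonneg _) (by linarith [hx i])
      change y i ≤ (1 + √D) * (2 * x i)
      linarith [hb i]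
  · intro y hy i
    exact lt_of_lt_of_le (mul_pos hm0 (half_pos (hx i))) (hy.1 i)
  · intro z hz
    refine ⟨fun y hy => ?_, fun k hk y hy => ?_⟩
    · have hb := (hball (hsub hy)).1
      have hy' := hSU (hball (hsub hy)).2
      refine ⟨fun i => ?_, fun i => ?_⟩
      · change m * (x i / 2) ≤ y i + K.φ y t z i
        have h1 : m * (x i / 2) ≤ m * y i := mul_le_mul_of_nonneg_left (hb i).1.le hm0.le
        have h2 : m * y i ≤ (1 + γ₀) * y i :=
          mul_le_mul_of_nonneg_right (min_le_right _ _) (hy' i).le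
        linarith [hlow y hy' t ht z hz i]
      · change y i + K.φ y t z i ≤ (1 + √D) * (2 * x i)
        have h1 := (le_abs_self _).trans (hjump y (hsub hy) z hz i)
        have h2 : (1 + √D) * y i ≤ (1 + √D) * (2 * x i) := by
          gcongr
          exact (hb i).2.le
        linarith
    · have hsm : ∀ w ∈ Metric.ball x r, ContDiffAt ℝ 2 (fun y => K.φ y t z) w := fun w hw =>
        (K.smooth t ht z hz).contDiffAt ((isOpen_posOrth n).mem_nhds (hSU (hball hw).2))
      have hLy := hL (fun y => K.φ y t z)
        (fun w hw => (hsm w hw).differentiableAt (by norm_num))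
        (fun w hw => ((hsm w hw).fderiv_right (m := 1) (by norm_num)).differentiableAt
          (by norm_num))
        (fun w hw => hjump' z hz w hw)
        (fun w hw => (norm_fderiv_fderiv_sub_le _ x w).trans <|
          ((hCh z hz).dist_le (hball hw).2 (mem_of_mem_nhds hS)).trans <| by
            have : dist w x ≤ r := (Metric.mem_ball.1 hw).le
            gcongr) y hy
      interval_cases k
      · rw [norm_iteratedFDeriv_zero]
        exact (hjump' z hz y (hsub hy)).trans (le_max_left _ _)
      · rw [norm_iteratedFDeriv_one]
        exact hLy.1.trans (le_max_right _ _)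
      · rw [norm_iteratedFDeriv_two]
        exact hLy.2.trans (le_max_right _ _)

theorem aestronglyMeasurable_compensated (K : JumpKernel n T) {f : (Fin n → ℝ) → ℝ}
    (hf : ContinuousOn f (posOrth n)) {y : Fin n → ℝ} (hy : y ∈ posOrth n) {t : ℝ}
    (ht : t ∈ Icc (0 : ℝ) T) :
    AEStronglyMeasurable (fun z => f (y + K.φ y t z) - f y - fderiv ℝ f y (K.φ y t z))
      (volume.restrict (Icc (0 : ℝ) 1)) := by
  classical
  have hφ : Measurable fun z => K.φ y t z := K.meas y hy t ht
  have hU : MeasurableSet (posOrth n) := (isOpen_posOrth n).measurableSet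
  have hg : Measurable ((posOrth n).piecewise f 0) :=
    hf.measurable_piecewise continuousOn_const hU
  have h1 : AEStronglyMeasurable (fun z => f (y + K.φ y t z))
      (volume.restrict (Icc (0 : ℝ) 1)) := by
    refine (hg.comp (hφ.const_add y)).aestronglyMeasurable.congr ?_
    filter_upwards [ae_restrict_mem measurableSet_Icc] with z hz
    exact piecewise_eq_of_mem _ _ _ (add_jump_mem_posOrth K hy ht hz)
  exact (h1.sub aestronglyMeasurable_const).sub
    ((fderiv ℝ f y).continuous.measurable.comp hφ).aestronglyMeasurable

theorem dmix_eq_fderiv_fderiv {F : Type*} [NormedAddCommGroup F] [NormedSpace ℝ F]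
    {f : (Fin n → ℝ) → F} {x : Fin n → ℝ} (hf : ContDiffAt ℝ 2 f x) (v w : Fin n → ℝ) :
    dmix f x v w = fderiv ℝ (fderiv ℝ f) x w v := by
  have h := ((hf.fderiv_right (m := 1) (by norm_num)).differentiableAt (by norm_num)).hasFDerivAt
  rw [dmix, (h.clm_apply (hasFDerivAt_const v x)).fderiv]
  simp

theorem dir2_compensated_eq_ohlyIntegrand (K : JumpKernel n T) {f : (Fin n → ℝ) → ℝ}
    (hf : ContDiffOn ℝ 3 f (posOrth n)) (hc : ConvexOn ℝ (posOrth n) f) {x v : Fin n → ℝ}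
    (hx : x ∈ posOrth n) (hv : dir2 f x v = 0) {t : ℝ} (ht : t ∈ Icc (0 : ℝ) T) {z : ℝ}
    (hz : z ∈ Icc (0 : ℝ) 1) :
    dir2 (fun y => f (y + K.φ y t z) - f y - fderiv ℝ f y (K.φ y t z)) x v =
      ohlyIntegrand K f x v t z := by
  have hU := isOpen_posOrth n
  have hf2 : ContDiffOn ℝ 2 f (posOrth n) := hf.of_le (by norm_num)
  have hp := add_jump_mem_posOrth K hx ht hz
  have hfp : ContDiffAt ℝ 2 f (x + K.φ x t z) := hf2.contDiffAt (hU.mem_nhds hp)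
  have hfx : ContDiffAt ℝ 2 f x := hf2.contDiffAt (hU.mem_nhds hx)
  have hφ : ContDiffAt ℝ 2 (fun y => K.φ y t z) x :=
    (K.smooth t ht z hz).contDiffAt (hU.mem_nhds hx)
  have hv' : fderiv ℝ (fderiv ℝ f) x v v = 0 := by
    rw [← dmix_eq_fderiv_fderiv hfx]; exact hv
  have hker := apply_eq_zero_of_apply_self_eq_zero (hfx.isSymmSndFDerivAt (by simp))
    (fun u => fderiv_fderiv_self_nonneg_of_convexOn hU hf2 hc hx u) hv'
  have hthird := fderiv_fderiv_fderiv_eq_zero_of_convexOn hU hf hc hx hv'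
  have hsymm := hfp.isSymmSndFDerivAt (by simp)
  have hmain := fderiv_fderiv_compensated_apply (hf.contDiffAt (hU.mem_nhds hx)) hfp hφ v
  rw [hv', hker, hthird] at hmain
  rw [dir2, dmix, hmain]
  simp only [ohlyIntegrand, dir1, dir2, dmix_eq_fderiv_fderiv hfp, dmix_eq_fderiv_fderiv hφ,
    map_add, _root_.add_apply]
  rw [hsymm v (fderiv ℝ (fun y => K.φ y t z) x v)]
  ring

theorem dir2_Bop_eq (K : JumpKernel n T) (lam : ℝ → ℝ) {f : (Fin n → ℝ) → ℝ}
    (hf : ContDiffOn ℝ 3 f (posOrth n)) (hc : ConvexOn ℝ (posOrth n) f) {x v : Fin n → ℝ}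
    (hx : x ∈ posOrth n) (hv : dir2 f x v = 0) {t : ℝ} (ht : t ∈ Icc (0 : ℝ) T) :
    dir2 (fun y => Bop lam K f y t) x v =
      lam t * ∫ z in Icc (0 : ℝ) 1, ohlyIntegrand K f x v t z := by
  obtain ⟨s, C, M, hs, hxs, hC, hsC, hCU, hK⟩ := K.exists_uniform_bounds hx ht
  have hU := isOpen_posOrth n
  obtain ⟨A, hA⟩ := exists_norm_iteratedFDeriv_compensated_le hU hs hC hsC hCU hf M
  have hmem : ∀ᵐ z ∂(volume.restrict (Icc (0 : ℝ) 1)), z ∈ Icc (0 : ℝ) 1 :=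
    ae_restrict_mem measurableSet_Icc
  have hφ : ∀ z ∈ Icc (0 : ℝ) 1, ContDiffOn ℝ 2 (fun y => K.φ y t z) s := fun z hz =>
    (K.smooth t ht z hz).mono (hsC.trans hCU)
  have hA' : ∀ z ∈ Icc (0 : ℝ) 1, ∀ k ≤ 2, ∀ y ∈ s, ‖iteratedFDeriv ℝ k
      (fun y => f (y + K.φ y t z) - f y - fderiv ℝ f y (K.φ y t z)) y‖ ≤ A := fun z hz =>
    hA _ (hφ z hz) (hK z hz).1 (hK z hz).2
  have hswap := fderiv_fderiv_integral_apply (μ := volume.restrict (Icc (0 : ℝ) 1)) (M := A)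
    (g := fun y z => f (y + K.φ y t z) - f y - fderiv ℝ f y (K.φ y t z)) hs
    (fun y hy => aestronglyMeasurable_compensated K hf.continuousOn (hCU (hsC hy)) ht)
    (hmem.mono fun z hz => contDiffOn_compensated hU (hsC.trans hCU) hf (hφ z hz)
      fun y hy => hCU ((hK z hz).1 hy))
    (hmem.mono fun z hz y hy => by
      simpa only [norm_iteratedFDeriv_zero] using hA' z hz 0 (by norm_num) y hy)
    (hmem.mono fun z hz y hy => by
      simpa only [norm_iteratedFDeriv_one] using hA' z hz 1 (by norm_num) y hy)
    (hmem.mono fun z hz y hy => by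
      simpa only [norm_iteratedFDeriv_two] using hA' z hz 2 le_rfl y hy) hxs v v
  have hscale : ∀ y, fderiv ℝ (fun y => Bop lam K f y t) y v = lam t • fderiv ℝ (fun y =>
      ∫ z in Icc (0 : ℝ) 1, (f (y + K.φ y t z) - f y - fderiv ℝ f y (K.φ y t z))) y v := by
    intro y
    exact DFunLike.congr_fun (congrFun (fderiv_const_smul_field (𝕜 := ℝ)
      (f := fun y => ∫ z in Icc (0 : ℝ) 1, (f (y + K.φ y t z) - f y - fderiv ℝ f y (K.φ y t z)))
      (lam t)) y) v
  have hint : ∫ z in Icc (0 : ℝ) 1, ohlyIntegrand K f x v t z =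
      ∫ z in Icc (0 : ℝ) 1,
        dir2 (fun y => f (y + K.φ y t z) - f y - fderiv ℝ f y (K.φ y t z)) x v :=
    setIntegral_congr_fun measurableSet_Icc fun z hz =>
      (dir2_compensated_eq_ohlyIntegrand K hf hc hx hv ht hz).symm
  rw [hint, dir2, dmix]
  simp only [hscale]
  refine Eq.trans ?_ (congrArg (lam t * ·) hswap)
  exact DFunLike.congr_fun (congrFun (fderiv_const_smul_field (𝕜 := ℝ)
    (f := fun y => fderiv ℝ (fun y => ∫ z in Icc (0 : ℝ) 1,
      (f (y + K.φ y t z) - f y - fderiv ℝ f y (K.φ y t z))) y v) (lam t)) x) v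

end JumpKernel

/-- Theorem 5.1: the operator `B` is LCP at a point `(x,t) ∈ (0,∞)ⁿ × [0,T]` if and only
if for all directions `v ≠ 0` and all convex `f ∈ F` with `∂_v²f(x) = 0`, condition (ohly)
holds: `∫₀¹ ( f_vv(x+φ) + 2 φ_v·∇f_v(x+φ) + φ_vᵀ Hf(x+φ) φ_v
+ φ_vv·(∇f(x+φ) − ∇f(x)) ) dz ≥ 0`. -/
theorem isLCPAt_Bop_iff_ohly {n : ℕ} {T : ℝ} (hT : 0 < T)
    (K : JumpKernel n T) (hK : K.AENonzero)
    (lam : ℝ → ℝ) (hlam : LamOK T lam)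
    (hlampos : ∀ s ∈ Set.Icc (0:ℝ) T, 0 < lam s)
    (x : Fin n → ℝ) (hx : x ∈ posOrth n)
    (t : ℝ) (ht : t ∈ Set.Icc (0:ℝ) T) :
    IsLCPAt (Bop lam K) x t ↔
      ∀ v : Fin n → ℝ, v ≠ 0 → ∀ f : (Fin n → ℝ) → ℝ,
        MemTestClass n f → ConvexOn ℝ (posOrth n) f → dir2 f x v = 0 →
        0 ≤ ∫ z in Icc (0:ℝ) 1, ohlyIntegrand K f x v t z := by
  have key : ∀ v f, MemTestClass n f → ConvexOn ℝ (posOrth n) f → dir2 f x v = 0 →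
      (0 ≤ dir2 (fun y => Bop lam K f y t) x v ↔
        0 ≤ ∫ z in Icc (0:ℝ) 1, ohlyIntegrand K f x v t z) := fun v f hf hc hv => by
    rw [dir2_Bop_eq K lam (hf.smooth.of_le (by norm_num)) hc hx hv ht,
      mul_nonneg_iff_of_pos_left (hlampos t ht)]
  exact forall₂_congr fun v _ => forall_congr' fun f =>
    forall₃_congr fun hf hc hv => key v f hf hc hv

end
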